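/- arXiv:1702.02918 — 5 statements merged into one kernel-verified Lean document; each statement's English description precedes it below -/
import Mathlib

section
/- Let ≺ be an admissible order on FreeMonoid σ and let I be any two-sided ideal of A = FreeAlgebra K σ. Then A is the internal direct sum, as a K-vector space, of I and the K-linear span of the words in nontip(I); that is, I ∩ span_K(nontip(I)) = 0 and I + span_K(nontip(I)) = A. -/
open scoped TensorProduct

noncomputable section

/-- The embedding of words into the free algebra, sending a word to the product of the
corresponding generators. -/
def wordEmb (K : Type*) [Field K] (σ : Type*) : FreeMonoid σ →* FreeAlgebra K σ :=
  FreeMonoid.lift (FreeAlgebra.ι K)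

/-- The coefficient function of an element of the free algebra with respect to the word basis. -/
def coeffw (K : Type*) [Field K] (σ : Type*) (x : FreeAlgebra K σ) : FreeMonoid σ →₀ K :=
  (FreeAlgebra.basisFreeMonoid K σ).repr x

/-- A `K`-submodule of the free algebra is a two-sided ideal if it is closed under
left and right multiplication by arbitrary elements. -/
def IsIdeal2 (K : Type*) [Field K] (σ : Type*) (I : Submodule K (FreeAlgebra K σ)) : Prop :=
  ∀ a b : FreeAlgebra K σ, ∀ x ∈ I, a * x * b ∈ I

/-- The two-sided ideal generated by a set `S`. -/
def idealGen (K : Type*) [Field K] (σ : Type*) (S : Set (FreeAlgebra K σ)) :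
    Submodule K (FreeAlgebra K σ) :=
  Submodule.span K {x | ∃ a s b, s ∈ S ∧ x = a * s * b}

/-- `lt` is an admissible order on `FreeMonoid σ`: a well-order compatible with
multiplication on both sides, and such that a word is ≤ any word containing it as a factor. -/
structure IsAdmissibleOrder {σ : Type*} (lt : FreeMonoid σ → FreeMonoid σ → Prop) : Prop where
  isWellOrder : IsWellOrder (FreeMonoid σ) lt
  mul_right : ∀ p q r : FreeMonoid σ, lt p q → lt (p * r) (q * r)
  mul_left : ∀ p q s : FreeMonoid σ, lt p q → lt (s * p) (s * q)
  le_mul : ∀ q r s : FreeMonoid σ, q = r * q * s ∨ lt q (r * q * s)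

/-- A length admissible order is an admissible order in which longer words are larger. -/
structure IsLengthAdmissibleOrder {σ : Type*} (lt : FreeMonoid σ → FreeMonoid σ → Prop)
    extends IsAdmissibleOrder lt : Prop where
  length_lt : ∀ p q : FreeMonoid σ, p.length < q.length → lt p q

/-- `t` is the tip (the largest word of the support with respect to `lt`) of `x`. -/
def IsTipOf (K : Type*) [Field K] {σ : Type*} (lt : FreeMonoid σ → FreeMonoid σ → Prop)
    (t : FreeMonoid σ) (x : FreeAlgebra K σ) : Prop :=
  coeffw K σ x t ≠ 0 ∧ ∀ u, coeffw K σ x u ≠ 0 → u = t ∨ lt u t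

/-- The set of tips of the nonzero elements of `S`. -/
def tipSet (K : Type*) [Field K] {σ : Type*} (lt : FreeMonoid σ → FreeMonoid σ → Prop)
    (S : Set (FreeAlgebra K σ)) : Set (FreeMonoid σ) :=
  {t | ∃ x ∈ S, IsTipOf K lt t x}

/-- The set of nontips of `S`: words which are not a tip of an element of `S`. -/
def nontipSet (K : Type*) [Field K] {σ : Type*} (lt : FreeMonoid σ → FreeMonoid σ → Prop)
    (S : Set (FreeAlgebra K σ)) : Set (FreeMonoid σ) :=
  {w | w ∉ tipSet K lt S}

/-- `G` is a Gröbner basis of the two-sided ideal `I` with respect to `lt`. -/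
def IsGrobnerBasis (K : Type*) [Field K] {σ : Type*}
    (lt : FreeMonoid σ → FreeMonoid σ → Prop) (G : Set (FreeAlgebra K σ))
    (I : Submodule K (FreeAlgebra K σ)) : Prop :=
  G ⊆ ↑I ∧ idealGen K σ (wordEmb K σ '' tipSet K lt G) = idealGen K σ (wordEmb K σ '' tipSet K lt ↑I)

/-- `x` is homogeneous of degree `d`: every word in its support has length `d`. -/
def IsHomogOfDeg (K : Type*) [Field K] {σ : Type*} (x : FreeAlgebra K σ) (d : ℕ) : Prop :=
  ∀ w : FreeMonoid σ, coeffw K σ x w ≠ 0 → w.length = d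


theorem basis_eq_wordEmb (K : Type*) [Field K] (σ : Type*) (w : FreeMonoid σ) :
    FreeAlgebra.basisFreeMonoid K σ w = wordEmb K σ w := by
  simp [FreeAlgebra.basisFreeMonoid, wordEmb, FreeAlgebra.equivMonoidAlgebraFreeMonoid,
    MonoidAlgebra.lift_apply]

/-- Fundamental Lemma: for any admissible order and any two-sided ideal `I`,
`A = I ⊕ span_K(nontip I)` as `K`-vector spaces. -/
theorem stmt0 (K : Type*) [Field K] (σ : Type*)
    (lt : FreeMonoid σ → FreeMonoid σ → Prop) (hlt : IsAdmissibleOrder lt)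
    (I : Submodule K (FreeAlgebra K σ)) (hI : IsIdeal2 K σ I) :
    I ⊓ Submodule.span K (wordEmb K σ '' nontipSet K lt (I : Set (FreeAlgebra K σ))) = ⊥ ∧
    I ⊔ Submodule.span K (wordEmb K σ '' nontipSet K lt (I : Set (FreeAlgebra K σ))) = ⊤ := by
  classical
  have hwo := hlt.isWellOrder
  have hb : (FreeAlgebra.basisFreeMonoid K σ : FreeMonoid σ → FreeAlgebra K σ) = wordEmb K σ :=
    funext (basis_eq_wordEmb K σ)
  rw [← hb]
  set b := FreeAlgebra.basisFreeMonoid K σ with hbdef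
  constructor
  · rw [eq_bot_iff]
    rintro x ⟨hxI, hxN⟩
    by_contra hx
    have hx0 : x ≠ 0 := fun h => hx (by simp [h])
    have hsupp := b.mem_span_image.1 hxN
    have hne : (b.repr x).support.Nonempty := by
      rw [Finsupp.support_nonempty_iff]
      simpa using hx0
    obtain ⟨t, ht, hmax⟩ : ∃ t ∈ (b.repr x).support, ∀ u ∈ (b.repr x).support,
        u = t ∨ lt u t := by
      letI := linearOrderOfSTO lt
      obtain ⟨t, ht, hm⟩ := Finset.exists_max_image _ id hne
      exact ⟨t, ht, fun u hu => hm u hu⟩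
    exact hsupp ht ⟨x, hxI, Finsupp.mem_support_iff.1 ht,
      fun u hu => hmax u (Finsupp.mem_support_iff.2 hu)⟩
  · have key : ∀ w, b w ∈ I ⊔ Submodule.span K
        (b '' nontipSet K lt (I : Set (FreeAlgebra K σ))) := by
      intro w
      induction w using hwo.wf.induction with
      | _ w ih =>
        by_cases hw : w ∈ nontipSet K lt (I : Set (FreeAlgebra K σ))
        · exact Submodule.mem_sup_right (Submodule.subset_span ⟨w, hw, rfl⟩)
        · obtain ⟨x, hxI, hc, hmax⟩ := not_not.1 hw
          change b.repr x w ≠ 0 at hc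
          have hsum := b.linearCombination_repr x
          rw [Finsupp.linearCombination_apply, Finsupp.sum,
            ← Finset.add_sum_erase _ _ (Finsupp.mem_support_iff.2 hc)] at hsum
          have hrest : ∑ u ∈ (b.repr x).support.erase w, b.repr x u • b u ∈
              I ⊔ Submodule.span K (b '' nontipSet K lt (I : Set (FreeAlgebra K σ))) := by
            refine Submodule.sum_mem _ fun u hu => Submodule.smul_mem _ _ (ih u ?_)
            rw [Finset.mem_erase, Finsupp.mem_support_iff] at hu
            exact (hmax u hu.2).resolve_left hu.1
          have h2 := Submodule.sub_mem _ (Submodule.mem_sup_left hxI) hrest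
          rw [← eq_sub_iff_add_eq.2 hsum] at h2
          exact (Submodule.smul_mem_iff _ hc).1 h2
    rw [eq_top_iff, ← b.span_eq, Submodule.span_le]
    rintro _ ⟨w, rfl⟩
    exact key w
end
end

section
/- Let T be a set of words in FreeMonoid σ and let L be the two-sided ideal of A = FreeAlgebra K σ generated by T. Then a word w lies in L if and only if some t ∈ T is a factor of w, i.e., w = p*t*q for words p, q. -/
open scoped TensorProduct

noncomputable section

theorem wordEmb_eq_basis (K : Type*) [Field K] (σ : Type*) :
    (wordEmb K σ : FreeMonoid σ → FreeAlgebra K σ) = FreeAlgebra.basisFreeMonoid K σ := by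
  funext w
  apply (FreeAlgebra.equivMonoidAlgebraFreeMonoid (R := K) (X := σ)).injective
  have h : ((FreeAlgebra.equivMonoidAlgebraFreeMonoid (R := K) (X := σ)) :
      FreeAlgebra K σ →* MonoidAlgebra K (FreeMonoid σ)).comp (wordEmb K σ)
      = MonoidAlgebra.of K (FreeMonoid σ) := by
    ext x
    simp [wordEmb, FreeAlgebra.equivMonoidAlgebraFreeMonoid]
  have h2 := DFunLike.congr_fun h w
  refine Eq.trans h2 ?_
  simp [FreeAlgebra.basisFreeMonoid]
  try rfl

theorem mem_span_wordEmb (K : Type*) [Field K] (σ : Type*) (a : FreeAlgebra K σ) :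
    a ∈ Submodule.span K (Set.range (wordEmb K σ)) := by
  rw [wordEmb_eq_basis, Module.Basis.span_eq]
  trivial

theorem mul_mem_span_factor (K : Type*) [Field K] (σ : Type*) (T : Set (FreeMonoid σ))
    (a b : FreeAlgebra K σ) (t : FreeMonoid σ) (ht : t ∈ T) :
    a * wordEmb K σ t * b ∈ Submodule.span K
      (wordEmb K σ '' {w | ∃ t ∈ T, ∃ p q : FreeMonoid σ, w = p * t * q}) := by
  induction mem_span_wordEmb K σ a using Submodule.span_induction with
  | zero => simp
  | add x y _ _ hx hy => rw [add_mul, add_mul]; exact add_mem hx hy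
  | smul c x _ hx => rw [smul_mul_assoc, smul_mul_assoc]; exact Submodule.smul_mem _ c hx
  | mem x hx =>
    obtain ⟨p, rfl⟩ := hx
    induction mem_span_wordEmb K σ b using Submodule.span_induction with
    | zero => simp
    | add x y _ _ hx hy => rw [mul_add]; exact add_mem hx hy
    | smul c x _ hx => rw [mul_smul_comm]; exact Submodule.smul_mem _ c hx
    | mem x hx =>
      obtain ⟨q, rfl⟩ := hx
      exact Submodule.subset_span ⟨p * t * q, ⟨t, ht, p, q, rfl⟩, by simp only [map_mul]⟩

/-- a word lies in the ideal generated by a set of words `T` iff it has a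
factor in `T`. -/
theorem stmt3 (K : Type*) [Field K] (σ : Type*)
    (T : Set (FreeMonoid σ)) (w : FreeMonoid σ) :
    wordEmb K σ w ∈ idealGen K σ (wordEmb K σ '' T) ↔
      ∃ t ∈ T, ∃ p q : FreeMonoid σ, w = p * t * q := by
  constructor
  · intro hw
    have hli : LinearIndependent K (wordEmb K σ) := by
      rw [wordEmb_eq_basis]
      exact Module.Basis.linearIndependent _
    have hle : idealGen K σ (wordEmb K σ '' T) ≤ Submodule.span K
        (wordEmb K σ '' {w | ∃ t ∈ T, ∃ p q : FreeMonoid σ, w = p * t * q}) := by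
      refine Submodule.span_le.2 ?_
      rintro x ⟨a, s, b, ⟨t, ht, rfl⟩, rfl⟩
      exact mul_mem_span_factor K σ T a b t ht
    by_contra hn
    exact hli.notMem_span_image (s := {w | ∃ t ∈ T, ∃ p q : FreeMonoid σ, w = p * t * q})
      hn (hle hw)
  · rintro ⟨t, ht, p, q, rfl⟩
    exact Submodule.subset_span
      ⟨wordEmb K σ p, wordEmb K σ t, wordEmb K σ q, ⟨t, ht, rfl⟩, by simp only [map_mul]⟩
end
end

section
/- Let T be a set of words in FreeMonoid σ, each of length at least 1, such that no element of T is a factor of a different element of T, and let L be the two-sided ideal of A = FreeAlgebra K σ generated by T. Then for any word w of length n ≥ 1, writing w = a*u and w = v*b where a, b are single letters and u, v are words of length n−1, one has: w ∈ T if and only if w ∈ L, u ∉ L, and v ∉ L. -/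
open scoped TensorProduct

noncomputable section

theorem span_wordEmb (K : Type*) [Field K] (σ : Type*) :
    Submodule.span K (Set.range (wordEmb K σ)) = ⊤ := by
  rw [← (FreeAlgebra.basisFreeMonoid K σ).span_eq]
  congr 2
  funext w
  exact (basis_eq_wordEmb K σ w).symm

theorem mem_idealGen_word (K : Type*) [Field K] (σ : Type*) (T : Set (FreeMonoid σ))
    (w : FreeMonoid σ) :
    wordEmb K σ w ∈ idealGen K σ (wordEmb K σ '' T) ↔ ∃ t ∈ T, ∃ p q, w = p * t * q := by
  constructor
  · intro h
    let F : Set (FreeMonoid σ) := {w | ∃ t ∈ T, ∃ p q, w = p * t * q}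
    have key : idealGen K σ (wordEmb K σ '' T) ≤
        Submodule.span K (FreeAlgebra.basisFreeMonoid K σ '' F) := by
      refine Submodule.span_le.2 ?_
      rintro _ ⟨a, _, b, ⟨t, ht, rfl⟩, rfl⟩
      have ha : a ∈ Submodule.span K (Set.range (wordEmb K σ)) := by
        rw [span_wordEmb]; trivial
      have hb : b ∈ Submodule.span K (Set.range (wordEmb K σ)) := by
        rw [span_wordEmb]; trivial
      rw [SetLike.mem_coe]
      induction ha using Submodule.span_induction with
      | zero => simp
      | add x y _ _ hx hy => rw [add_mul, add_mul]; exact add_mem hx hy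
      | smul c x _ hx =>
        rw [smul_mul_assoc, smul_mul_assoc]; exact Submodule.smul_mem _ c hx
      | mem x hx =>
        obtain ⟨p, rfl⟩ := hx
        induction hb using Submodule.span_induction with
        | zero => simp
        | add x y _ _ hx hy => rw [mul_add]; exact add_mem hx hy
        | smul c x _ hx => rw [mul_smul_comm]; exact Submodule.smul_mem _ c hx
        | mem x hx =>
          obtain ⟨q, rfl⟩ := hx
          rw [← map_mul, ← map_mul, ← basis_eq_wordEmb]
          exact Submodule.subset_span ⟨_, ⟨t, ht, p, q, rfl⟩, rfl⟩
    have h2 := key h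
    rw [← basis_eq_wordEmb] at h2
    exact ((FreeAlgebra.basisFreeMonoid K σ).linearIndependent.notMem_span_image.mt
      (not_not.2 h2) |> not_not.1 : w ∈ F)
  · rintro ⟨t, ht, p, q, rfl⟩
    rw [map_mul, map_mul]
    exact Submodule.subset_span ⟨_, _, _, ⟨t, ht, rfl⟩, rfl⟩

/-- characterization of membership in `T` for `T` a set of words of length ≥ 1,
none a factor of a different one. -/
theorem stmt4 (K : Type*) [Field K] (σ : Type*)
    (T : Set (FreeMonoid σ))
    (hlen : ∀ t ∈ T, 1 ≤ t.length)
    (hfac : ∀ t ∈ T, ∀ t' ∈ T, t ≠ t' → ¬ ∃ p q : FreeMonoid σ, t' = p * t * q)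
    (w u v : FreeMonoid σ) (a b : σ)
    (hw1 : w = FreeMonoid.of a * u) (hw2 : w = v * FreeMonoid.of b) :
    w ∈ T ↔ (wordEmb K σ w ∈ idealGen K σ (wordEmb K σ '' T) ∧
      wordEmb K σ u ∉ idealGen K σ (wordEmb K σ '' T) ∧
      wordEmb K σ v ∉ idealGen K σ (wordEmb K σ '' T)) := by
  simp only [mem_idealGen_word]
  constructor
  · intro hw
    refine ⟨⟨w, hw, 1, 1, by simp⟩, ?_, ?_⟩
    · rintro ⟨t, ht, p, q, rfl⟩
      by_cases e : t = w
      · have := congrArg FreeMonoid.length (e.trans hw1)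
        simp [FreeMonoid.length_mul] at this
        omega
      · exact hfac t ht w hw e ⟨FreeMonoid.of a * p, q, by rw [hw1]; simp only [mul_assoc]⟩
    · rintro ⟨t, ht, p, q, rfl⟩
      by_cases e : t = w
      · have := congrArg FreeMonoid.length (e.trans hw2)
        simp [FreeMonoid.length_mul] at this
        omega
      · exact hfac t ht w hw e ⟨p, q * FreeMonoid.of b, by rw [hw2]; simp only [mul_assoc]⟩
  · rintro ⟨⟨t, ht, p, q, h⟩, hu, hv⟩
    have hp : p = 1 := by
      rcases List.eq_nil_or_concat (FreeMonoid.toList p) with e | _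
      · exact e
      cases hpl : FreeMonoid.toList p with
      | nil => exact hpl
      | cons c l =>
        exfalso
        apply hu
        refine ⟨t, ht, FreeMonoid.ofList l, q, ?_⟩
        have hp' : p = FreeMonoid.of c * FreeMonoid.ofList l := hpl
        rw [hw1, hp'] at h
        have h' : a :: FreeMonoid.toList u =
          c :: FreeMonoid.toList (FreeMonoid.ofList l * t * q) := by
          have := congrArg FreeMonoid.toList h
          simp only [mul_assoc] at this ⊢
          exact this
        exact (List.cons.inj h').2
    have hq : q = 1 := by
      rcases List.eq_nil_or_concat (FreeMonoid.toList q) with e | ⟨l, c, e⟩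
      · exact e
      · exfalso
        apply hv
        refine ⟨t, ht, p, FreeMonoid.ofList l, ?_⟩
        have hq' : q = FreeMonoid.ofList l * FreeMonoid.of c := by
          rw [List.concat_eq_append] at e
          exact e
        rw [hw2, hq'] at h
        have h' : FreeMonoid.toList v ++ [b] =
          FreeMonoid.toList (p * t * FreeMonoid.ofList l) ++ [c] := by
          have := congrArg FreeMonoid.toList h
          rw [← mul_assoc] at this
          exact this
        exact (List.append_inj' h' rfl).1
    subst hp hq
    rw [h]; simpa using ht
end
end

section
/- Let ≺ be a length admissible order on FreeMonoid σ and let I be a two-sided ideal of A = FreeAlgebra K σ generated by homogeneous elements. Let T be the unique minimal set of words generating the monomial ideal ⟨tip(I)⟩, and for each t ∈ T write t = g_t + n_t with g_t ∈ I and n_t ∈ span_K(nontip(I)) (such a decomposition exists and is unique by the Fundamental Lemma). Then each g_t is homogeneous of degree equal to the length of t, tip(g_t) = t, and the set G = {g_t : t ∈ T} is a Gröbner basis of I with respect to ≺, i.e., the ideal generated by tip(G) equals the ideal generated by tip(I). -/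
open scoped TensorProduct

noncomputable section

theorem word_induction {K : Type*} [Field K] {σ : Type*} {P : FreeAlgebra K σ → Prop}
    (zero : P 0) (add : ∀ x y, P x → P y → P (x + y)) (smul : ∀ (c : K) x, P x → P (c • x))
    (basis : ∀ w, P (FreeAlgebra.basisFreeMonoid K σ w)) (x : FreeAlgebra K σ) : P x := by
  have hx : x ∈ Submodule.span K (Set.range (FreeAlgebra.basisFreeMonoid K σ)) := by
    rw [Module.Basis.span_eq]; trivial
  induction hx using Submodule.span_induction with
  | mem x h => obtain ⟨w, rfl⟩ := h; exact basis w
  | zero => exact zero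
  | add x y _ _ hx hy => exact add x y hx hy
  | smul c x _ hx => exact smul c x hx

open Classical in
/-- Homogeneous component of degree `d`. -/
def hcomp (K : Type*) [Field K] (σ : Type*) (d : ℕ) :
    FreeAlgebra K σ →ₗ[K] FreeAlgebra K σ :=
  (FreeAlgebra.basisFreeMonoid K σ).constr K
    (fun w => if w.length = d then FreeAlgebra.basisFreeMonoid K σ w else 0)

open Classical in
theorem coeffw_wordEmb (K : Type*) [Field K] (σ : Type*) (w u : FreeMonoid σ) :
    coeffw K σ (wordEmb K σ w) u = if w = u then 1 else 0 := by
  rw [← basis_eq_wordEmb, coeffw, Module.Basis.repr_self, Finsupp.single_apply]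

open Classical in
theorem coeffw_hcomp (K : Type*) [Field K] (σ : Type*) (d : ℕ) (x : FreeAlgebra K σ)
    (u : FreeMonoid σ) :
    coeffw K σ (hcomp K σ d x) u = if u.length = d then coeffw K σ x u else 0 := by
  induction x using word_induction with
  | zero => simp [coeffw]
  | add x y hx hy =>
    simp only [coeffw, map_add, Finsupp.add_apply] at hx hy ⊢
    rw [hx, hy]; split_ifs <;> simp
  | smul c x hx =>
    simp only [coeffw, map_smul, Finsupp.smul_apply] at hx ⊢
    rw [hx]; split_ifs <;> simp
  | basis w =>
    rw [hcomp, Module.Basis.constr_basis]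
    by_cases h : w = u
    · subst h; split_ifs <;> simp [coeffw]
    · split_ifs <;> simp [coeffw, h]

theorem coeffw_ext (K : Type*) [Field K] (σ : Type*) {x y : FreeAlgebra K σ}
    (h : ∀ u, coeffw K σ x u = coeffw K σ y u) : x = y :=
  (FreeAlgebra.basisFreeMonoid K σ).repr.injective (Finsupp.ext h)

theorem homog_mul (K : Type*) [Field K] (σ : Type*) {x y : FreeAlgebra K σ} {d e : ℕ}
    (hx : IsHomogOfDeg K x d) (hy : IsHomogOfDeg K y e) : IsHomogOfDeg K (x * y) (d + e) := by
  classical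
  have key : ∀ z : FreeAlgebra K σ, coeffw K σ z =
      (FreeAlgebra.equivMonoidAlgebraFreeMonoid z).coeff := fun z => by
    ext; simp [coeffw, FreeAlgebra.basisFreeMonoid]
  intro w hw
  by_contra hne
  apply hw
  rw [key, map_mul, MonoidAlgebra.coeff_mul]
  refine Finset.sum_eq_zero fun a ha => Finset.sum_eq_zero fun b hb => ?_
  rw [← key] at ha hb
  have h1 := hx a (by simpa using ha)
  have h2 := hy b (by simpa using hb)
  have : a * b ≠ w := by
    rintro rfl
    exact hne (by rw [FreeMonoid.length_mul, h1, h2])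
  simp [this]

theorem homog_word (K : Type*) [Field K] (σ : Type*) (w : FreeMonoid σ) :
    IsHomogOfDeg K (FreeAlgebra.basisFreeMonoid K σ w) w.length := by
  classical
  intro u hu
  rw [basis_eq_wordEmb, coeffw_wordEmb] at hu
  have : w = u := by by_contra h; simp [h] at hu
  rw [this]

theorem hcomp_homog (K : Type*) [Field K] (σ : Type*) {x : FreeAlgebra K σ} {e : ℕ}
    (hx : IsHomogOfDeg K x e) (d : ℕ) : hcomp K σ d x = x ∨ hcomp K σ d x = 0 := by
  classical
  by_cases h : e = d
  · left
    apply coeffw_ext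
    intro u
    rw [coeffw_hcomp]
    split_ifs with hu
    · rfl
    · by_contra hc
      exact hu (h ▸ hx u (fun h0 => hc h0.symm))
  · right
    apply coeffw_ext
    intro u
    rw [coeffw_hcomp]
    split_ifs with hu
    · by_contra hc
      exact h ((hx u (fun h0 => hc (by rw [h0]; simp [coeffw]))).symm.trans hu)
    · simp [coeffw]

theorem hcomp_mem (K : Type*) [Field K] (σ : Type*) (S : Set (FreeAlgebra K σ))
    (hS : ∀ s ∈ S, ∃ d, IsHomogOfDeg K s d) (d : ℕ) (x : FreeAlgebra K σ)
    (hx : x ∈ idealGen K σ S) : hcomp K σ d x ∈ idealGen K σ S := by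
  suffices h : idealGen K σ S ≤ (idealGen K σ S).comap (hcomp K σ d) from h hx
  refine Submodule.span_le.2 ?_
  rintro _ ⟨a, s, b, hs, rfl⟩
  obtain ⟨e, he⟩ := hS s hs
  change hcomp K σ d (a * s * b) ∈ idealGen K σ S
  induction a using word_induction with
  | zero => simp
  | add x y hx hy => rw [add_mul, add_mul, map_add]; exact add_mem hx hy
  | smul c x hx =>
    rw [smul_mul_assoc, smul_mul_assoc, map_smul]; exact Submodule.smul_mem _ _ hx
  | basis w =>
  induction b using word_induction with
  | zero => simp
  | add x y hx hy => rw [mul_add, map_add]; exact add_mem hx hy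
  | smul c x hx => rw [mul_smul_comm, map_smul]; exact Submodule.smul_mem _ _ hx
  | basis v =>
    rcases hcomp_homog K σ (homog_mul K σ (homog_mul K σ (homog_word K σ w) he)
      (homog_word K σ v)) d with h | h
    · rw [h]; exact Submodule.subset_span ⟨_, s, _, hs, rfl⟩
    · rw [h]; exact zero_mem _

theorem exists_tip (K : Type*) [Field K] {σ : Type*}
    {lt : FreeMonoid σ → FreeMonoid σ → Prop} (hlt : IsWellOrder (FreeMonoid σ) lt)
    {x : FreeAlgebra K σ} (hx : x ≠ 0) : ∃ t, IsTipOf K lt t x := by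
  classical
  letI := linearOrderOfSTO lt
  have hne : (coeffw K σ x).support.Nonempty := by
    rw [Finsupp.support_nonempty_iff]
    intro h
    exact hx ((FreeAlgebra.basisFreeMonoid K σ).repr.map_eq_zero_iff.1 h)
  obtain ⟨t, ht, hm⟩ := Finset.exists_max_image _ id hne
  refine ⟨t, by simpa using ht, fun u hu => ?_⟩
  exact (hm u (by simpa using hu)).eq_or_lt

theorem tip_unique (K : Type*) [Field K] {σ : Type*}
    {lt : FreeMonoid σ → FreeMonoid σ → Prop} (hlt : IsWellOrder (FreeMonoid σ) lt)
    {x : FreeAlgebra K σ} {t u : FreeMonoid σ} (ht : IsTipOf K lt t x) (hu : IsTipOf K lt u x) :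
    t = u := by
  rcases hu.2 t ht.1 with h | h
  · exact h
  rcases ht.2 u hu.1 with h' | h'
  · exact h'.symm
  exact absurd h' (asymm h)

theorem coeffw_span (K : Type*) [Field K] {σ : Type*} (N : Set (FreeMonoid σ))
    (x : FreeAlgebra K σ) (hx : x ∈ Submodule.span K (wordEmb K σ '' N)) (u : FreeMonoid σ)
    (hu : coeffw K σ x u ≠ 0) : u ∈ N := by
  classical
  by_contra hN
  apply hu
  induction hx using Submodule.span_induction with
  | mem x h =>
    obtain ⟨w, hw, rfl⟩ := h
    rw [coeffw_wordEmb, if_neg]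
    rintro rfl
    exact hN hw
  | zero => simp [coeffw]
  | add x y _ _ hx hy =>
    by_contra hc
    by_cases h1 : coeffw K σ x u = 0
    · by_cases h2 : coeffw K σ y u = 0
      · apply hc
        simp only [coeffw, map_add, Finsupp.add_apply] at h1 h2 ⊢
        rw [h1, h2, add_zero]
      · exact h2 (hy h2)
    · exact h1 (hx h1)
  | smul c x _ hx =>
    by_cases h1 : coeffw K σ x u = 0
    · simp only [coeffw, map_smul, Finsupp.smul_apply] at h1 ⊢
      rw [h1, smul_zero]
    · exact absurd (hx h1) h1

/-- the reduced Gröbner basis: homogeneity, tips, and the Gröbner property. -/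
theorem stmt6 (K : Type*) [Field K] (σ : Type*)
    (lt : FreeMonoid σ → FreeMonoid σ → Prop) (hlt : IsLengthAdmissibleOrder lt)
    (I : Submodule K (FreeAlgebra K σ)) (hI : IsIdeal2 K σ I)
    (hgen : ∃ S : Set (FreeAlgebra K σ),
      (∀ s ∈ S, ∃ d, IsHomogOfDeg K s d) ∧ I = idealGen K σ S)
    (T : Set (FreeMonoid σ))
    (hTgen : idealGen K σ (wordEmb K σ '' T)
      = idealGen K σ (wordEmb K σ '' tipSet K lt (I : Set (FreeAlgebra K σ))))
    (hTmin : ∀ T' : Set (FreeMonoid σ),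
      idealGen K σ (wordEmb K σ '' T')
        = idealGen K σ (wordEmb K σ '' tipSet K lt (I : Set (FreeAlgebra K σ))) → T ⊆ T')
    (g : FreeMonoid σ → FreeAlgebra K σ)
    (hg : ∀ t ∈ T, g t ∈ I ∧
      wordEmb K σ t - g t ∈
        Submodule.span K (wordEmb K σ '' nontipSet K lt (I : Set (FreeAlgebra K σ)))) :
    (∀ t ∈ T, IsHomogOfDeg K (g t) t.length ∧ IsTipOf K lt t (g t)) ∧
    IsGrobnerBasis K lt (g '' T) I := by
  classical
  have hwo := hlt.isWellOrder
  have hT : T ⊆ tipSet K lt (I : Set (FreeAlgebra K σ)) := hTmin _ rfl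
  have hsub : ∀ x y u, coeffw K σ (x - y) u = coeffw K σ x u - coeffw K σ y u := by
    intro x y u; simp [coeffw]
  -- every word other than `t` in the support of `g t` is a nontip
  have hsupp : ∀ t ∈ T, ∀ u, u ≠ t → coeffw K σ (g t) u ≠ 0 →
      u ∈ nontipSet K lt (I : Set (FreeAlgebra K σ)) := by
    intro t ht u hut hu
    refine coeffw_span K _ _ (hg t ht).2 u ?_
    rw [hsub, coeffw_wordEmb, if_neg (Ne.symm hut), zero_sub]
    exact neg_ne_zero.2 hu
  have hone : ∀ t ∈ T, coeffw K σ (g t) t ≠ 0 := by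
    intro t ht h0
    refine coeffw_span K _ _ (hg t ht).2 t ?_ (hT ht)
    rw [hsub, coeffw_wordEmb, if_pos rfl, h0, sub_zero]
    exact one_ne_zero
  have htip : ∀ t ∈ T, IsTipOf K lt t (g t) := by
    intro t ht
    have hne : g t ≠ 0 := by
      intro h
      apply hone t ht
      rw [h]; simp [coeffw]
    obtain ⟨w, hw⟩ := exists_tip K hwo hne
    by_cases h : w = t
    · exact h ▸ hw
    · exact absurd ⟨g t, (hg t ht).1, hw⟩ (hsupp t ht w h hw.1)
  refine ⟨fun t ht => ⟨?_, htip t ht⟩, ?_, ?_⟩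
  · obtain ⟨S, hS, hIS⟩ := hgen
    have hmem : hcomp K σ t.length (g t) ∈ I := by
      have := (hg t ht).1
      rw [hIS] at this ⊢
      exact hcomp_mem K σ S hS _ _ this
    have hz : g t - hcomp K σ t.length (g t) = 0 := by
      by_contra hne
      obtain ⟨w, hw⟩ := exists_tip K hwo hne
      have h1 := hw.1
      rw [hsub, coeffw_hcomp] at h1
      by_cases hl : w.length = t.length
      · simp [hl] at h1
      · rw [if_neg hl, sub_zero] at h1
        exact hsupp t ht w (fun h => hl (by rw [h])) h1 ⟨_, I.sub_mem (hg t ht).1 hmem, hw⟩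
    intro w hw
    by_contra hl
    rw [sub_eq_zero.1 hz, coeffw_hcomp, if_neg hl] at hw
    exact hw rfl
  · rintro _ ⟨t, ht, rfl⟩
    exact (hg t ht).1
  · have : tipSet K lt (g '' T) = T := by
      ext w
      constructor
      · rintro ⟨_, ⟨t, ht, rfl⟩, hw⟩
        exact tip_unique K hwo (htip t ht) hw ▸ ht
      · intro hw
        exact ⟨g w, ⟨w, hw, rfl⟩, htip w hw⟩
    rw [this, hTgen]
end
end

section
/- Let λ, γ ∈ K and let I be the two-sided ideal of the free algebra A = K⟨x,y⟩ generated by the single element y*x − λ·x*y − γ·x². Then the images under the quotient map A → A/I of the monomials x^i * y^j, for i, j ≥ 0, form a K-basis of A/I. -/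
open scoped TensorProduct

noncomputable section

/-- The coefficient `c_i` in `y x^i = lam^i x^i y + c_i x^(i+1)`. -/
def cseq {K : Type*} [Field K] (lam gam : K) : ℕ → K
  | 0 => 0
  | (i + 1) => lam * cseq lam gam i + gam

/-- The action of `x`. -/
def opX (K : Type*) [Field K] : Module.End K ((ℕ × ℕ) →₀ K) :=
  Finsupp.linearCombination K (fun p : ℕ × ℕ => Finsupp.single (p.1 + 1, p.2) (1 : K))

/-- The action of `y`. -/
def opY {K : Type*} [Field K] (lam gam : K) : Module.End K ((ℕ × ℕ) →₀ K) :=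
  Finsupp.linearCombination K (fun p : ℕ × ℕ =>
    lam ^ p.1 • Finsupp.single (p.1, p.2 + 1) (1 : K)
      + cseq lam gam p.1 • Finsupp.single (p.1 + 1, p.2) (1 : K))

theorem opX_single (K : Type*) [Field K] (i j : ℕ) :
    opX K (Finsupp.single (i, j) 1) = Finsupp.single (i + 1, j) 1 := by
  simp [opX]

theorem opY_single {K : Type*} [Field K] (lam gam : K) (i j : ℕ) :
    opY lam gam (Finsupp.single (i, j) 1) = lam ^ i • Finsupp.single (i, j + 1) (1 : K)
      + cseq lam gam i • Finsupp.single (i + 1, j) (1 : K) := by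
  simp only [opY, Finsupp.linearCombination_single, one_smul]

theorem op_rel {K : Type*} [Field K] (lam gam : K) :
    opY lam gam * opX K - lam • (opX K * opY lam gam) - gam • (opX K * opX K)
      = (0 : Module.End K ((ℕ × ℕ) →₀ K)) := by
  refine Finsupp.lhom_ext' fun p => LinearMap.ext_ring ?_
  obtain ⟨i, j⟩ := p
  simp only [LinearMap.comp_apply, Finsupp.lsingle_apply, LinearMap.sub_apply, LinearMap.zero_apply,
    LinearMap.smul_apply, Module.End.mul_apply, opX_single, opY_single, map_add, map_smul, cseq]
  module

/-- The representation of the free algebra. -/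
def rep {K : Type*} [Field K] (lam gam : K) :
    FreeAlgebra K (Fin 2) →ₐ[K] Module.End K ((ℕ × ℕ) →₀ K) :=
  FreeAlgebra.lift K ![opX K, opY lam gam]

theorem rep_mon {K : Type*} [Field K] (lam gam : K) (i j : ℕ) :
    rep lam gam (FreeAlgebra.ι K (0 : Fin 2) ^ i * FreeAlgebra.ι K (1 : Fin 2) ^ j)
      (Finsupp.single (0, 0) 1) = Finsupp.single (i, j) 1 := by
  have hY : ∀ j : ℕ, (opY lam gam ^ j) (Finsupp.single (0, 0) (1 : K))
      = Finsupp.single (0, j) 1 := by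
    intro j
    induction j with
    | zero => simp
    | succ j ih => rw [pow_succ', Module.End.mul_apply, ih, opY_single]; simp [cseq]
  have hX : ∀ i : ℕ, (opX K ^ i) (Finsupp.single (0, j) (1 : K))
      = Finsupp.single (i, j) 1 := by
    intro i
    induction i with
    | zero => simp
    | succ i ih => rw [pow_succ', Module.End.mul_apply, ih, opX_single]
  simp [rep, hY, hX]

theorem idealGen_mul (K : Type*) [Field K] (σ : Type*) (S : Set (FreeAlgebra K σ))
    (c d : FreeAlgebra K σ) {z : FreeAlgebra K σ} (hz : z ∈ idealGen K σ S) :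
    c * z * d ∈ idealGen K σ S := by
  unfold idealGen at hz ⊢
  induction hz using Submodule.span_induction with
  | mem z h =>
    obtain ⟨a, s, b, hs, rfl⟩ := h
    exact Submodule.subset_span ⟨c * a, s, b * d, hs, by simp only [mul_assoc]⟩
  | zero => simp
  | add u v _ _ hu hv => rw [mul_add, add_mul]; exact add_mem hu hv
  | smul k u _ hu => rw [mul_smul_comm, smul_mul_assoc]; exact Submodule.smul_mem _ _ hu

/-- the monomials `x^i y^j` form a `K`-basis of
`K⟨x,y⟩/(yx - λ xy - γ x²)`. -/
theorem stmt11 (K : Type*) [Field K] (lam gam : K)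
    (I : Submodule K (FreeAlgebra K (Fin 2)))
    (hI : I = idealGen K (Fin 2)
      {FreeAlgebra.ι K (1 : Fin 2) * FreeAlgebra.ι K (0 : Fin 2)
        - lam • (FreeAlgebra.ι K (0 : Fin 2) * FreeAlgebra.ι K (1 : Fin 2))
        - gam • (FreeAlgebra.ι K (0 : Fin 2) * FreeAlgebra.ι K (0 : Fin 2))}) :
    LinearIndependent K (fun p : ℕ × ℕ =>
      I.mkQ (FreeAlgebra.ι K (0 : Fin 2) ^ p.1 * FreeAlgebra.ι K (1 : Fin 2) ^ p.2)) ∧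
    Submodule.span K (Set.range (fun p : ℕ × ℕ =>
      I.mkQ (FreeAlgebra.ι K (0 : Fin 2) ^ p.1 * FreeAlgebra.ι K (1 : Fin 2) ^ p.2))) = ⊤ := by
  set x := FreeAlgebra.ι K (0 : Fin 2) with hx
  set y := FreeAlgebra.ι K (1 : Fin 2) with hy
  have hmul : ∀ c d z : FreeAlgebra K (Fin 2), z ∈ I → c * z * d ∈ I := by
    intro c d z hz
    subst hI
    exact idealGen_mul _ _ _ c d hz
  have hrel : y * x - lam • (x * y) - gam • (x * x) ∈ I := by
    rw [hI]
    exact Submodule.subset_span ⟨1, _, 1, rfl, by simp⟩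
  constructor
  · let f : FreeAlgebra K (Fin 2) →ₗ[K] ((ℕ × ℕ) →₀ K) :=
      (LinearMap.applyₗ (Finsupp.single (0, 0) (1 : K))).comp (rep lam gam).toLinearMap
    have hf : I ≤ LinearMap.ker f := by
      rw [hI, idealGen, Submodule.span_le]
      rintro _ ⟨a, s, b, rfl, rfl⟩
      have h0 : rep lam gam (y * x - lam • (x * y) - gam • (x * x)) = 0 := by
        rw [← op_rel lam gam]
        simp [rep, hx, hy]
      change rep lam gam (a * _ * b) _ = 0
      rw [map_mul, map_mul, h0]
      simp
    refine LinearIndependent.of_comp (I.liftQ f hf) ?_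
    have he : (I.liftQ f hf) ∘ (fun p : ℕ × ℕ => I.mkQ (x ^ p.1 * y ^ p.2))
        = fun p : ℕ × ℕ => Finsupp.single p (1 : K) := by
      funext p
      exact rep_mon lam gam p.1 p.2
    rw [he]
    exact Finsupp.linearIndependent_single_one K (ℕ × ℕ)
  · have hyx : ∀ i : ℕ,
        y * x ^ i - lam ^ i • (x ^ i * y) - cseq lam gam i • x ^ (i + 1) ∈ I := by
      intro i
      induction i with
      | zero => simp [cseq]
      | succ i ih =>
        have h1 := hmul 1 (x ^ i) _ hrel
        have h2 := I.smul_mem lam (hmul x 1 _ ih)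
        convert add_mem h1 h2 using 1
        simp only [cseq, one_mul, mul_one, sub_mul, mul_sub, smul_sub, smul_mul_assoc,
          mul_smul_comm, pow_succ', mul_assoc]
        module
    set T := (Submodule.span K (Set.range (fun p : ℕ × ℕ =>
      I.mkQ (x ^ p.1 * y ^ p.2)))).comap I.mkQ with hT
    have hIT : ∀ z ∈ I, z ∈ T := by
      intro z hz
      have : I.mkQ z = 0 := by simpa using hz
      rw [hT, Submodule.mem_comap, this]
      exact zero_mem _
    have hmon : ∀ i j : ℕ, x ^ i * y ^ j ∈ T := fun i j =>
      Submodule.subset_span ⟨(i, j), rfl⟩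
    have key : ∀ a : FreeAlgebra K (Fin 2), (∀ i j : ℕ, a * (x ^ i * y ^ j) ∈ T) →
        ∀ z ∈ T, a * z ∈ T := by
      intro a ha z hz
      have hTle : T ≤ Submodule.span K (Set.range (fun p : ℕ × ℕ => x ^ p.1 * y ^ p.2)) ⊔ I := by
        intro z hz
        rw [hT, Submodule.mem_comap] at hz
        have : (Set.range (fun p : ℕ × ℕ => I.mkQ (x ^ p.1 * y ^ p.2)))
          = I.mkQ '' (Set.range (fun p : ℕ × ℕ => x ^ p.1 * y ^ p.2)) := by
          rw [← Set.range_comp]; rfl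
        rw [this, ← Submodule.map_span, ← Submodule.mem_comap, Submodule.comap_map_eq,
          Submodule.ker_mkQ] at hz
        exact hz
      have hle : Submodule.span K (Set.range (fun p : ℕ × ℕ => x ^ p.1 * y ^ p.2)) ⊔ I
          ≤ T.comap (LinearMap.mulLeft K a) := by
        refine sup_le (Submodule.span_le.2 ?_) ?_
        · rintro _ ⟨p, rfl⟩
          exact ha p.1 p.2
        · intro w hw
          exact hIT _ (by simpa using hmul a 1 w hw)
      exact hle (hTle hz)
    have hall : ∀ a : FreeAlgebra K (Fin 2), ∀ z ∈ T, a * z ∈ T := by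
      intro a
      induction a using FreeAlgebra.induction with
      | grade0 r =>
        intro z hz
        rw [← Algebra.smul_def]
        exact T.smul_mem r hz
      | grade1 k =>
        apply key
        intro i j
        fin_cases k
        · change x * (x ^ i * y ^ j) ∈ T
          rw [← mul_assoc, ← pow_succ']
          exact hmon _ _
        · change y * (x ^ i * y ^ j) ∈ T
          have h1 := hIT _ (hmul 1 (y ^ j) _ (hyx i))
          have h2 := T.smul_mem (lam ^ i) (hmon i (j + 1))
          have h3 := T.smul_mem (cseq lam gam i) (hmon (i + 1) j)
          convert add_mem (add_mem h1 h2) h3 using 1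
          simp only [one_mul, sub_mul, smul_mul_assoc, pow_succ' y, mul_assoc]
          module
      | mul a b ha hb =>
        intro z hz
        rw [mul_assoc]
        exact ha _ (hb _ hz)
      | add a b ha hb =>
        intro z hz
        rw [add_mul]
        exact add_mem (ha _ hz) (hb _ hz)
    rw [eq_top_iff]
    rintro q -
    obtain ⟨a, rfl⟩ := I.mkQ_surjective q
    have := hall a 1 (by simpa using hmon 0 0)
    rw [mul_one] at this
    exact this
end
end
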